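/- Let n, N ≥ 1 and κ, K > 0. There exists a constant c_a depending only on n, N, κ and K with the following property: for every bilinear form 𝒜 on Hom(ℝⁿ;ℝ^N) that is elliptic in the sense of Legendre–Hadamard with ellipticity constant κ and satisfies |𝒜(A,B)| ≤ K|A||B| for all A, B ∈ Hom(ℝⁿ;ℝ^N), for every ball B_ρ(x₀) ⊂ ℝⁿ, and for every function h : B_ρ(x₀) → ℝ^N which is smooth on B_ρ(x₀), has |Dh| integrable over B_ρ(x₀), and is 𝒜-harmonic, i.e. ∫_{B_ρ(x₀)} 𝒜(Dh, Dφ) dx = 0 for every φ ∈ C¹ with compact support in B_ρ(x₀) and values in ℝ^N, one has ρ · sup_{B_{ρ/2}(x₀)} |D²h| + sup_{B_{ρ/2}(x₀)} |Dh| ≤ c_a ⨍_{B_ρ(x₀)} |Dh| dx. -/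

import Mathlib

open MeasureTheory

set_option linter.unusedSectionVars false
set_option linter.unusedVariables false

namespace AHarm
open scoped ContDiff

section
variable {E F G : Type*} [NormedAddCommGroup E] [InnerProductSpace ℝ E] [FiniteDimensional ℝ E]
  [MeasurableSpace E] [BorelSpace E]
  [NormedAddCommGroup F] [InnerProductSpace ℝ F] [FiniteDimensional ℝ F]
  [NormedAddCommGroup G] [NormedSpace ℝ G]

noncomputable def pd (v : E) (g : E → G) : E → G := fun x => fderiv ℝ g x v

lemma pd_contDiff {v : E} {g : E → G} (hg : ContDiff ℝ ∞ g) : ContDiff ℝ ∞ (pd v g) := by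
  have := hg.fderiv_right (m := ∞) (by simp)
  exact this.clm_apply contDiff_const

lemma pd_tsupport (v : E) (g : E → G) : tsupport (pd v g) ⊆ tsupport g :=
  tsupport_fderiv_apply_subset ℝ v

lemma pd_comm (v w : E) {g : E → G} (hg : ContDiff ℝ ∞ g) : pd v (pd w g) = pd w (pd v g) := by
  have hd : ∀ x, DifferentiableAt ℝ (fderiv ℝ g) x := fun x =>
    ((hg.fderiv_right (m := ∞) (by simp)).differentiable (by simp)) x
  have key : ∀ v w x, pd v (pd w g) x = fderiv ℝ (fderiv ℝ g) x v w := by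
    intro v w x
    have h1 : HasFDerivAt (fun y => fderiv ℝ g y w)
        ((fderiv ℝ (fderiv ℝ g) x).flip w) x := by
      have := (hd x).hasFDerivAt.clm_apply (hasFDerivAt_const w x)
      simpa using this
    show fderiv ℝ (fun y => fderiv ℝ g y w) x v = _
    rw [h1.fderiv]; rfl
  funext x
  rw [key, key]
  have : IsSymmSndFDerivAt ℝ g x := hg.contDiffAt.isSymmSndFDerivAt (by
    simp only [minSmoothness_of_isRCLikeNormedField]; exact WithTop.coe_le_coe.2 le_top)
  exact this v w

lemma pd_pd (v w : E) {g : E → G} (hg : ContDiff ℝ ∞ g) (x : E) :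
    pd v (pd w g) x = fderiv ℝ (fderiv ℝ g) x v w := by
  have hd : DifferentiableAt ℝ (fderiv ℝ g) x :=
    ((hg.fderiv_right (m := ∞) (by simp)).differentiable (by simp)) x
  have h1 : HasFDerivAt (fun y => fderiv ℝ g y w)
      ((fderiv ℝ (fderiv ℝ g) x).flip w) x := by
    have := hd.hasFDerivAt.clm_apply (hasFDerivAt_const w x)
    simpa using this
  show fderiv ℝ (fun y => fderiv ℝ g y w) x v = _
  rw [h1.fderiv]; rfl

noncomputable def cs (ξ : E) (θ : ℝ) : E → ℝ := fun x => Real.cos (inner ℝ ξ x + θ)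

lemma cs_contDiff (ξ : E) (θ : ℝ) : ContDiff ℝ ∞ (cs ξ θ) := by
  unfold cs
  exact Real.contDiff_cos.comp ((contDiff_const.inner ℝ contDiff_id).add contDiff_const)

lemma pd_cs (v ξ : E) (θ : ℝ) (x : E) :
    pd v (cs ξ θ) x = inner ℝ ξ v * cs ξ (θ + Real.pi / 2) x := by
  have h1 : HasFDerivAt (fun x : E => inner ℝ ξ x + θ) (innerSL ℝ ξ) x :=
    (innerSL ℝ ξ).hasFDerivAt.add_const θ
  have h2 := h1.cos
  show fderiv ℝ (fun x : E => Real.cos (inner ℝ ξ x + θ)) x v = _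
  rw [h2.fderiv]
  simp only [cs, ← add_assoc, Real.cos_add_pi_div_two]
  simp [mul_comm]

lemma cs_shift (ξ : E) (θ : ℝ) (x : E) :
    cs ξ (θ + Real.pi / 2 + Real.pi / 2) x = - cs ξ θ x := by
  simp only [cs]
  rw [← Real.cos_add_pi]; ring_nf

lemma cs_abs (ξ : E) (θ : ℝ) (x : E) : |cs ξ θ x| ≤ 1 := Real.abs_cos_le_one _

lemma pd_mul {v : E} {g h : E → ℝ} (hg : ContDiff ℝ ∞ g) (hh : ContDiff ℝ ∞ h) (x : E) :
    pd v (fun y => g y * h y) x = pd v g x * h x + g x * pd v h x := by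
  have h1 : HasFDerivAt (fun y => g y * h y) _ x :=
    (hg.differentiable (by simp) x).hasFDerivAt.mul (hh.differentiable (by simp) x).hasFDerivAt
  show fderiv ℝ (fun y => g y * h y) x v = _
  rw [h1.fderiv]
  simp [pd]; ring

lemma pd_mul_cs {v ξ : E} {θ : ℝ} {g : E → ℝ} (hg : ContDiff ℝ ∞ g) :
    pd v (fun y => g y * cs ξ θ y) =
      fun x => pd v g x * cs ξ θ x + inner ℝ ξ v * (g x * cs ξ (θ + Real.pi / 2) x) := by
  funext x
  rw [pd_mul hg (cs_contDiff ξ θ), pd_cs]; ring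

lemma pd_pd_mul_cs {v w ξ : E} {θ : ℝ} {g : E → ℝ} (hg : ContDiff ℝ ∞ g) (x : E) :
    pd w (pd v (fun y => g y * cs ξ θ y)) x =
      pd w (pd v g) x * cs ξ θ x + inner ℝ ξ w * (pd v g x * cs ξ (θ + Real.pi / 2) x)
      + inner ℝ ξ v * (pd w g x * cs ξ (θ + Real.pi / 2) x)
      - inner ℝ ξ v * inner ℝ ξ w * (g x * cs ξ θ x) := by
  rw [pd_mul_cs hg]
  have c1 : ContDiff ℝ ∞ (fun x => pd v g x * cs ξ θ x) := (pd_contDiff hg).mul (cs_contDiff ξ θ)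
  have c2 : ContDiff ℝ ∞ (fun x => g x * cs ξ (θ + Real.pi / 2) x) := hg.mul (cs_contDiff ξ _)
  have h1 := ((c1.differentiable (by simp) x).hasFDerivAt.add
    ((c2.differentiable (by simp) x).hasFDerivAt.const_mul (inner ℝ ξ v)))
  have h2 : pd w (fun x => pd v g x * cs ξ θ x + inner ℝ ξ v * (g x * cs ξ (θ + Real.pi / 2) x)) x
     = pd w (fun x => pd v g x * cs ξ θ x) x
       + inner ℝ ξ v * pd w (fun x => (g x * cs ξ (θ + Real.pi / 2) x)) x := by
    show fderiv ℝ (fun x => pd v g x * cs ξ θ x + inner ℝ ξ v * (g x * cs ξ (θ + Real.pi / 2) x)) x w = _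
    have h1' : HasFDerivAt (fun x => pd v g x * cs ξ θ x + inner ℝ ξ v * (g x * cs ξ (θ + Real.pi / 2) x)) _ x := h1
    rw [h1'.fderiv]; simp [pd]
  rw [h2, pd_mul_cs (pd_contDiff hg), pd_mul_cs hg]
  simp only [cs_shift]
  ring

/-- elementary tensor -/
noncomputable def T (η : E) (f : F) : E →L[ℝ] F := (innerSL ℝ η).smulRight f

lemma T_norm (η : E) (f : F) : ‖T η f‖ = ‖η‖ * ‖f‖ := by
  simp [T]

noncomputable def TL (η : E) : F →ₗ[ℝ] (E →L[ℝ] F) where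
  toFun := T η
  map_add' := by intro x y; ext; simp [T]
  map_smul' := by intro c y; ext z; simp only [T, ContinuousLinearMap.smulRight_apply, RingHom.id_apply, _root_.smul_apply]; rw [smul_comm]

noncomputable def TR (f : F) : E →ₗ[ℝ] (E →L[ℝ] F) where
  toFun η := T η f
  map_add' := by intro x y; ext; simp [T, add_smul]
  map_smul' := by intro x y; ext; simp [T, mul_smul]

abbrev S : Set E := Metric.closedBall (0:E) (3/4)

abbrev Form (E F : Type*) [NormedAddCommGroup E] [InnerProductSpace ℝ E]
  [NormedAddCommGroup F] [InnerProductSpace ℝ F] := (E →L[ℝ] F) →ₗ[ℝ] (E →L[ℝ] F) →ₗ[ℝ] ℝ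

structure Ell (κ K : ℝ) (𝒜 : Form E F) : Prop where
  lower : ∀ (η : E) (ξ : F), κ * ‖η‖ ^ 2 * ‖ξ‖ ^ 2 ≤ 𝒜 (T η ξ) (T η ξ)
  upper : ∀ A B : E →L[ℝ] F, |𝒜 A B| ≤ K * ‖A‖ * ‖B‖

structure Sol {ι : Type*} [Fintype ι] (b : OrthonormalBasis ι ℝ E) (𝒜 : Form E F) (u : E → F) : Prop where
  cont : Continuous u
  eqn : ∀ ψ : E → ℝ, ContDiff ℝ ∞ ψ → tsupport ψ ⊆ S → ∀ f : F,
    ∑ i, ∑ j, 𝒜 (T (b j) (∫ x, pd (b j) (pd (b i) ψ) x • u x)) (T (b i) f) = 0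

lemma hcs {g : E → G} (h : tsupport g ⊆ S) : HasCompactSupport g :=
  (isCompact_closedBall (0:E) (3/4)).of_isClosed_subset (isClosed_tsupport g) h

noncomputable def I (u : E → F) (ζ : E → ℝ) (ξ : E) (θ : ℝ) : F := ∫ x, (ζ x * cs ξ θ x) • u x

lemma int_I {u : E → F} (hu : Continuous u) {ζ : E → ℝ} (hζ : ContDiff ℝ ∞ ζ) (hs : tsupport ζ ⊆ S)
    (ξ : E) (θ : ℝ) : Integrable (fun x => (ζ x * cs ξ θ x) • u x) := by
  apply Continuous.integrable_of_hasCompactSupport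
  · exact (hζ.continuous.mul (cs_contDiff ξ θ).continuous).smul hu
  · exact ((hcs hs).mul_right).smul_right

lemma I_bound {u : E → F} (hu : Continuous u) {ζ : E → ℝ} (hζ : ContDiff ℝ ∞ ζ) (hs : tsupport ζ ⊆ S)
    {C : ℝ} (hC : ∀ x, |ζ x| ≤ C) (ξ : E) (θ : ℝ) : ‖I u ζ ξ θ‖ ≤ C * ∫ x in S, ‖u x‖ := by
  unfold I
  have : ∫ x, (ζ x * cs ξ θ x) • u x = ∫ x in S, (ζ x * cs ξ θ x) • u x := by
    rw [setIntegral_eq_integral_of_forall_compl_eq_zero]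
    intro x hx
    have : ζ x = 0 := image_eq_zero_of_notMem_tsupport (fun h => hx (hs h))
    simp [this]
  rw [this, ← integral_const_mul]
  refine norm_integral_le_of_norm_le ?_ ?_
  · exact ((hu.norm.const_smul C).continuousOn).integrableOn_compact (isCompact_closedBall _ _)
  · refine Filter.Eventually.of_forall fun x => ?_
    rw [norm_smul, Real.norm_eq_abs, abs_mul]
    gcongr
    calc |ζ x| * |cs ξ θ x| ≤ C * 1 := by
          gcongr
          · exact (abs_nonneg _).trans (hC x)
          · exact hC x
          · exact cs_abs _ _ _
      _ = C := mul_one C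

lemma int4 {f1 f2 f3 f4 : E → F} (h1 : Integrable f1) (h2 : Integrable f2) (h3 : Integrable f3)
    (h4 : Integrable f4) : ∫ x, (f1 x + f2 x + f3 x - f4 x) =
      (∫ x, f1 x) + (∫ x, f2 x) + (∫ x, f3 x) - ∫ x, f4 x := by
  have h12 : Integrable (fun x => f1 x + f2 x) := h1.add h2
  have h123 : Integrable (fun x => f1 x + f2 x + f3 x) := h12.add h3
  rw [integral_sub h123 h4, integral_add h12 h3, integral_add h1 h2]

lemma J_eq {u : E → F} (hu : Continuous u) {ζ : E → ℝ} (hζ : ContDiff ℝ ∞ ζ) (hs : tsupport ζ ⊆ S)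
    (ξ : E) (θ : ℝ) (v w : E) :
    ∫ x, pd w (pd v (fun y => ζ y * cs ξ θ y)) x • u x =
      I u (pd w (pd v ζ)) ξ θ + (inner ℝ ξ w) • I u (pd v ζ) ξ (θ + Real.pi / 2)
       + (inner ℝ ξ v) • I u (pd w ζ) ξ (θ + Real.pi / 2)
       - (inner ℝ ξ v * inner ℝ ξ w) • I u ζ ξ θ := by
  have i1 := int_I hu (pd_contDiff (v := w) (pd_contDiff (v := v) hζ))
    ((pd_tsupport _ _).trans ((pd_tsupport _ _).trans hs)) ξ θ
  have i2 := int_I hu (pd_contDiff (v := v) hζ) ((pd_tsupport _ _).trans hs) ξ (θ + Real.pi / 2)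
  have i3 := int_I hu (pd_contDiff (v := w) hζ) ((pd_tsupport _ _).trans hs) ξ (θ + Real.pi / 2)
  have i4 := int_I hu hζ hs ξ θ
  unfold I
  have i2' : Integrable (fun x => inner ℝ ξ w • ((pd v ζ x * cs ξ (θ + Real.pi / 2) x) • u x)) := i2.smul _
  have i3' : Integrable (fun x => inner ℝ ξ v • ((pd w ζ x * cs ξ (θ + Real.pi / 2) x) • u x)) := i3.smul _
  have i4' : Integrable (fun x => (inner ℝ ξ v * inner ℝ ξ w) • ((ζ x * cs ξ θ x) • u x)) := i4.smul _
  rw [← integral_smul, ← integral_smul, ← integral_smul, ← int4 i1 i2' i3' i4']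
  congr 1; funext x
  rw [pd_pd_mul_cs hζ]
  simp only [smul_smul, ← add_smul, ← sub_smul]

lemma sum_form {ι : Type*} [Fintype ι] (b : OrthonormalBasis ι ℝ E) (𝒜 : Form E F) (ξ : E) (f g : F) :
    ∑ i, ∑ j, 𝒜 (T (b j) ((inner ℝ ξ (b i) * inner ℝ ξ (b j)) • f)) (T (b i) g) = 𝒜 (T ξ f) (T ξ g) := by
  have hξ : ∀ h : F, T ξ h = ∑ i, (inner ℝ ξ (b i)) • T (b i) h := by
    intro h
    have : ξ = ∑ i, (inner ℝ ξ (b i)) • b i := by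
      conv_lhs => rw [← b.sum_repr' ξ]
      simp [real_inner_comm]
    conv_lhs => rw [this]
    show TR h _ = _
    simp only [map_sum, map_smul]; rfl
  have hs : ∀ (η : E) (c : ℝ) (h : F), T η (c • h) = c • T η h := fun η c h => (TL η).map_smul c h
  rw [hξ f, hξ g]
  simp only [map_sum, map_smul, hs, LinearMap.sum_apply, LinearMap.smul_apply, smul_eq_mul, Finset.mul_sum]
  refine Finset.sum_congr rfl fun i _ => Finset.sum_congr rfl fun j _ => ?_
  ring

lemma key_est {ι : Type*} [Fintype ι] (b : OrthonormalBasis ι ℝ E) {κ K : ℝ} (hκ : 0 < κ) (hK : 0 < K)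
    {𝒜 : Form E F} (hA : Ell κ K 𝒜) {u : E → F} (hu : Sol b 𝒜 u)
    {ζ : E → ℝ} (hζ : ContDiff ℝ ∞ ζ) (hs : tsupport ζ ⊆ S) (ξ : E) (θ : ℝ) :
    ‖ξ‖ ^ 2 * ‖I u ζ ξ θ‖ ≤ K / κ * ∑ i, ∑ j, (‖I u (pd (b j) (pd (b i) ζ)) ξ θ‖ +
      ‖ξ‖ * ‖I u (pd (b i) ζ) ξ (θ + Real.pi / 2)‖ + ‖ξ‖ * ‖I u (pd (b j) ζ) ξ (θ + Real.pi / 2)‖) := by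
  set f := I u ζ ξ θ with hf
  set R : ι → ι → F := fun i j => I u (pd (b j) (pd (b i) ζ)) ξ θ
      + (inner ℝ ξ (b j)) • I u (pd (b i) ζ) ξ (θ + Real.pi / 2)
      + (inner ℝ ξ (b i)) • I u (pd (b j) ζ) ξ (θ + Real.pi / 2) with hR
  have hb : ∀ i, |inner ℝ ξ (b i)| ≤ ‖ξ‖ := fun i => by
    simpa using abs_real_inner_le_norm ξ (b i)
  have hRn : ∀ i j, ‖R i j‖ ≤ ‖I u (pd (b j) (pd (b i) ζ)) ξ θ‖ +
      ‖ξ‖ * ‖I u (pd (b i) ζ) ξ (θ + Real.pi / 2)‖ + ‖ξ‖ * ‖I u (pd (b j) ζ) ξ (θ + Real.pi / 2)‖ := by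
    intro i j
    refine (norm_add₃_le).trans ?_
    rw [norm_smul, norm_smul, Real.norm_eq_abs, Real.norm_eq_abs]
    gcongr <;> apply hb
  have h0 := hu.eqn (fun y => ζ y * cs ξ θ y) (hζ.mul (cs_contDiff ξ θ))
    ((tsupport_mul_subset_left).trans hs) f
  have hsub : ∀ (η : E) (g h : F), T η (g - h) = T η g - T η h := fun η g h => (TL η).map_sub g h
  have h1 : 𝒜 (T ξ f) (T ξ f) = ∑ i, ∑ j, 𝒜 (T (b j) (R i j)) (T (b i) f) := by
    have : ∀ i j, ∫ x, pd (b j) (pd (b i) (fun y => ζ y * cs ξ θ y)) x • u x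
       = R i j - (inner ℝ ξ (b i) * inner ℝ ξ (b j)) • f := fun i j => J_eq hu.cont hζ hs ξ θ _ _
    simp only [this, hsub, map_sub, LinearMap.sub_apply, Finset.sum_sub_distrib, sum_form] at h0
    linarith
  have h2 : κ * ‖ξ‖ ^ 2 * ‖f‖ ^ 2 ≤ K * (∑ i, ∑ j, ‖R i j‖) * ‖f‖ := by
    refine (hA.lower ξ f).trans ?_
    rw [h1, Finset.mul_sum, Finset.sum_mul]
    refine Finset.sum_le_sum fun i _ => ?_
    rw [Finset.mul_sum, Finset.sum_mul]
    refine Finset.sum_le_sum fun j _ => ?_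
    refine (le_abs_self _).trans ((hA.upper _ _).trans ?_)
    rw [T_norm, T_norm]; simp
  have h3 : κ * (‖ξ‖ ^ 2 * ‖f‖) ≤ K * (∑ i, ∑ j, ‖R i j‖) := by
    by_cases h : ‖f‖ = 0
    · rw [h]; simp; positivity
    · have : 0 < ‖f‖ := lt_of_le_of_ne (norm_nonneg _) (Ne.symm h)
      refine le_of_mul_le_mul_right ?_ this
      linarith
  have h4 : ‖ξ‖ ^ 2 * ‖f‖ ≤ K / κ * (∑ i, ∑ j, ‖R i j‖) := by
    rw [div_mul_eq_mul_div, le_div_iff₀ hκ]; linarith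
  refine h4.trans ?_
  gcongr
  exact hRn _ _

lemma decay {ι : Type*} [Fintype ι] (b : OrthonormalBasis ι ℝ E) {κ K : ℝ} (hκ : 0 < κ) (hK : 0 < K)
    (m : ℕ) : ∀ ζ : E → ℝ, ContDiff ℝ ∞ ζ → tsupport ζ ⊆ S → ∃ C : ℝ, 0 ≤ C ∧
      ∀ (𝒜 : Form E F), Ell κ K 𝒜 → ∀ u : E → F, Sol b 𝒜 u → ∀ ξ θ,
        (1 + ‖ξ‖) ^ m * ‖I u ζ ξ θ‖ ≤ C * ∫ x in S, ‖u x‖ := by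
  have base : ∀ ζ : E → ℝ, ContDiff ℝ ∞ ζ → tsupport ζ ⊆ S → ∃ C : ℝ, 0 ≤ C ∧
      ∀ (u : E → F), Continuous u → ∀ ξ θ, ‖I u ζ ξ θ‖ ≤ C * ∫ x in S, ‖u x‖ := by
    intro ζ hζ hs
    obtain ⟨C, hC⟩ := (hcs hs).exists_bound_of_continuous hζ.continuous
    exact ⟨C, (norm_nonneg _).trans (hC 0), fun u hu ξ θ => I_bound hu hζ hs hC ξ θ⟩
  induction m with
  | zero =>
    intro ζ hζ hs
    obtain ⟨C, h0, hC⟩ := base ζ hζ hs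
    exact ⟨C, h0, fun 𝒜 _ u hu ξ θ => by simpa using hC u hu.cont ξ θ⟩
  | succ m ih =>
    intro ζ hζ hs
    obtain ⟨C0, hC0, hB⟩ := base ζ hζ hs
    have s1 : ∀ i, tsupport (pd (b i) ζ) ⊆ S := fun i => (pd_tsupport _ _).trans hs
    choose C1 hC1 hB1 using fun i => ih (pd (b i) ζ) (pd_contDiff hζ) (s1 i)
    choose C2 hC2 hB2 using fun i j => ih (pd (b j) (pd (b i) ζ)) (pd_contDiff (pd_contDiff hζ))
      ((pd_tsupport _ _).trans (s1 i))
    set D := ∑ i, ∑ j, (C2 i j + C1 i + C1 j) with hD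
    have hD0 : 0 ≤ D := Finset.sum_nonneg fun i _ => Finset.sum_nonneg fun j _ => by
      have := hC2 i j; have := hC1 i; have := hC1 j; positivity
    refine ⟨2 ^ (m+1) * C0 + 2 * (K / κ) * D, by positivity, ?_⟩
    intro 𝒜 hA u hu ξ θ
    set U := ∫ x in S, ‖u x‖ with hU
    have hU0 : 0 ≤ U := integral_nonneg fun _ => norm_nonneg _
    rcases le_total ‖ξ‖ 1 with h | h
    · calc (1 + ‖ξ‖) ^ (m+1) * ‖I u ζ ξ θ‖ ≤ 2 ^ (m+1) * (C0 * U) := by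
            gcongr
            · linarith
            · exact hB u hu.cont ξ θ
        _ ≤ _ := by
            rw [add_mul, mul_assoc]
            have : 0 ≤ 2 * (K / κ) * D * U := by positivity
            linarith
    · have hk := key_est b hκ hK hA hu hζ hs ξ θ
      have h1 : ‖ξ‖ * ‖I u ζ ξ θ‖ ≤ K / κ * ∑ i, ∑ j, (‖I u (pd (b j) (pd (b i) ζ)) ξ θ‖ +
        ‖I u (pd (b i) ζ) ξ (θ + Real.pi / 2)‖ + ‖I u (pd (b j) ζ) ξ (θ + Real.pi / 2)‖) := by
        refine le_of_mul_le_mul_left ?_ (by linarith : 0 < ‖ξ‖)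
        calc ‖ξ‖ * (‖ξ‖ * ‖I u ζ ξ θ‖) = ‖ξ‖ ^ 2 * ‖I u ζ ξ θ‖ := by ring
          _ ≤ _ := hk
          _ ≤ K / κ * ∑ i, ∑ j, ‖ξ‖ * (‖I u (pd (b j) (pd (b i) ζ)) ξ θ‖ +
        ‖I u (pd (b i) ζ) ξ (θ + Real.pi / 2)‖ + ‖I u (pd (b j) ζ) ξ (θ + Real.pi / 2)‖) := by
              gcongr with i _ j _
              have := le_mul_of_one_le_left (norm_nonneg (I u (pd (b j) (pd (b i) ζ)) ξ θ)) h
              linarith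
          _ = _ := by
              simp only [← Finset.mul_sum]; ring
      have h2 : (1 + ‖ξ‖) ^ m * ∑ i, ∑ j, (‖I u (pd (b j) (pd (b i) ζ)) ξ θ‖ +
        ‖I u (pd (b i) ζ) ξ (θ + Real.pi / 2)‖ + ‖I u (pd (b j) ζ) ξ (θ + Real.pi / 2)‖) ≤ D * U := by
        rw [hD, Finset.mul_sum, Finset.sum_mul]
        refine Finset.sum_le_sum fun i _ => ?_
        rw [Finset.mul_sum, Finset.sum_mul]
        refine Finset.sum_le_sum fun j _ => ?_
        have a1 := hB1 i 𝒜 hA u hu ξ (θ + Real.pi / 2)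
        have a2 := hB1 j 𝒜 hA u hu ξ (θ + Real.pi / 2)
        have a3 := hB2 i j 𝒜 hA u hu ξ θ
        linarith
      calc (1 + ‖ξ‖) ^ (m+1) * ‖I u ζ ξ θ‖ = (1 + ‖ξ‖) ^ m * ((1 + ‖ξ‖) * ‖I u ζ ξ θ‖) := by ring
        _ ≤ (1 + ‖ξ‖) ^ m * ((2 * ‖ξ‖) * ‖I u ζ ξ θ‖) := by gcongr; linarith
        _ = 2 * ((1 + ‖ξ‖) ^ m * (‖ξ‖ * ‖I u ζ ξ θ‖)) := by ring
        _ ≤ 2 * ((1 + ‖ξ‖) ^ m * (K / κ * ∑ i, ∑ j, (‖I u (pd (b j) (pd (b i) ζ)) ξ θ‖ +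
        ‖I u (pd (b i) ζ) ξ (θ + Real.pi / 2)‖ + ‖I u (pd (b j) ζ) ξ (θ + Real.pi / 2)‖))) := by
            gcongr
        _ = 2 * (K / κ) * ((1 + ‖ξ‖) ^ m * (∑ i, ∑ j, (‖I u (pd (b j) (pd (b i) ζ)) ξ θ‖ +
        ‖I u (pd (b i) ζ) ξ (θ + Real.pi / 2)‖ + ‖I u (pd (b j) ζ) ξ (θ + Real.pi / 2)‖))) := by ring
        _ ≤ 2 * (K / κ) * (D * U) := by gcongr
        _ ≤ _ := by
            rw [add_mul, mul_assoc, mul_assoc]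
            have : 0 ≤ 2 ^ (m+1) * (C0 * U) := by positivity
            linarith

lemma inv_bound : ∃ Cn : ℝ, 0 ≤ Cn ∧ ∀ w : E → ℝ, Continuous w → Integrable w → ∀ A : ℝ, 0 ≤ A →
    (∀ ξ θ, (1 + ‖ξ‖) ^ (Module.finrank ℝ E + 1) * |∫ x, w x * cs ξ θ x| ≤ A) →
    ∀ x, |w x| ≤ Cn * A := by
  set d := Module.finrank ℝ E with hd
  have hint : Integrable (fun x : E => (1 + ‖x‖) ^ (-((d:ℝ) + 1))) :=
    integrable_one_add_norm (by simp [hd])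
  refine ⟨2 * ∫ x : E, (1 + ‖x‖) ^ (-((d:ℝ) + 1)), ?_, ?_⟩
  · have : 0 ≤ ∫ x : E, (1 + ‖x‖) ^ (-((d:ℝ) + 1)) := integral_nonneg fun x => by positivity
    positivity
  intro w hw hwi A hA0 hA x
  set W : E → ℂ := fun x => (w x : ℂ) with hW
  have hWi : Integrable W := hwi.ofReal
  have hform : ∀ ξ : E, FourierTransform.fourier W ξ =
      ((∫ x, w x * cs ((2 * Real.pi) • ξ) 0 x : ℝ) : ℂ) +
        Complex.I * ((∫ x, w x * cs ((2 * Real.pi) • ξ) (Real.pi / 2) x : ℝ) : ℂ) := by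
    intro ξ
    have hi : ∀ θ, Integrable (fun x => w x * cs ((2 * Real.pi) • ξ) θ x) := by
      intro θ
      refine hwi.mul_bdd (c := 1) (cs_contDiff _ _).continuous.aestronglyMeasurable ?_
      exact Filter.Eventually.of_forall fun x => cs_abs _ _ _
    rw [Real.fourier_eq', ← integral_complex_ofReal, ← integral_complex_ofReal, ← integral_const_mul,
      ← integral_add (hi _).ofReal ((hi _).ofReal.const_mul _)]
    congr 1; funext y
    rw [Complex.exp_mul_I]
    simp only [cs, inner_smul_left, hW, Real.cos_add_pi_div_two, add_zero, smul_eq_mul,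
      ← Complex.ofReal_cos, ← Complex.ofReal_sin]
    have : (-2 * Real.pi * inner ℝ y ξ) = - (2 * Real.pi * inner ℝ ξ y) := by
      rw [real_inner_comm]; ring
    rw [this, Real.cos_neg, Real.sin_neg]
    simp
    ring
  have hb : ∀ ξ : E, ‖FourierTransform.fourier W ξ‖ ≤ 2 * A * (1 + ‖ξ‖) ^ (-((d:ℝ) + 1)) := by
    intro ξ
    have hpos : 0 < (1 + ‖ξ‖) ^ (d + 1) := by positivity
    have e : (1 + ‖ξ‖) ^ (-((d:ℝ) + 1)) = ((1 + ‖ξ‖) ^ (d + 1))⁻¹ := by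
      rw [Real.rpow_neg (by positivity)]
      congr 1
      exact_mod_cast Real.rpow_natCast (1 + ‖ξ‖) (d+1)
    have hθ : ∀ θ, |∫ x, w x * cs ((2 * Real.pi) • ξ) θ x| ≤ A * ((1 + ‖ξ‖) ^ (d + 1))⁻¹ := by
      intro θ
      rw [← div_eq_mul_inv, le_div_iff₀ hpos, mul_comm]
      refine le_trans ?_ (hA ((2 * Real.pi) • ξ) θ)
      gcongr
      rw [norm_smul, Real.norm_of_nonneg (by positivity)]
      have := Real.pi_gt_three
      exact le_mul_of_one_le_left (norm_nonneg _) (by linarith)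
    rw [hform, e]
    refine (norm_add_le _ _).trans ?_
    rw [norm_mul, Complex.norm_I, one_mul, Complex.norm_real, Complex.norm_real,
      Real.norm_eq_abs, Real.norm_eq_abs]
    have := hθ 0; have := hθ (Real.pi / 2)
    linarith
  have hcont : Continuous (FourierTransform.fourier W) :=
    VectorFourier.fourierIntegral_continuous Real.continuous_fourierChar (by exact continuous_inner) hWi
  have hFi : Integrable (FourierTransform.fourier W) :=
    (hint.const_mul (2 * A)).mono' hcont.aestronglyMeasurable (Filter.Eventually.of_forall hb)
  have hinv := hWi.fourierInv_fourier_eq hFi (v := x) (by fun_prop)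
  have : |w x| = ‖W x‖ := by simp [hW]
  rw [this, ← hinv, Real.fourierInv_eq']
  calc _ ≤ ∫ ξ, 2 * A * (1 + ‖ξ‖) ^ (-((d:ℝ) + 1)) := by
        refine norm_integral_le_of_norm_le (hint.const_mul (2 * A)) (Filter.Eventually.of_forall fun ξ => ?_)
        rw [norm_smul, Complex.norm_exp_ofReal_mul_I, one_mul]
        exact hb ξ
    _ = _ := by rw [integral_const_mul]; ring

lemma int_sm {u : E → F} (hu : Continuous u) {g : E → ℝ} (hg : ContDiff ℝ ∞ g) (hs : tsupport g ⊆ S) :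
    Integrable (fun x => g x • u x) := by
  apply Continuous.integrable_of_hasCompactSupport
  · exact hg.continuous.smul hu
  · exact (hcs hs).smul_right

lemma swap {H : E → F} (hH : ContDiff ℝ ∞ H) {g : E → ℝ} (hg : ContDiff ℝ ∞ g) (hs : tsupport g ⊆ S)
    (v w : E) : ∫ x, pd v g x • pd w H x = ∫ x, pd w g x • pd v H x := by
  have key : ∀ v w : E, ∫ x, pd v g x • pd w H x = - ∫ x, g x • pd v (pd w H) x := by
    intro v w
    have := integral_smul_fderiv_eq_neg_fderiv_smul_of_integrable (μ := (volume : Measure E))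
      (f := g) (g := pd w H) (v := v)
      (int_sm (pd_contDiff hH).continuous (pd_contDiff (v := v) hg) ((pd_tsupport _ _).trans hs))
      (int_sm (pd_contDiff (pd_contDiff hH)).continuous hg hs)
      (int_sm (pd_contDiff hH).continuous hg hs)
      (fun x _ => hg.differentiable (by simp) x)
      (fun x _ => (pd_contDiff hH).differentiable (by simp) x)
    have h2 : ∫ x, g x • pd v (pd w H) x = - ∫ x, pd v g x • pd w H x := this
    rw [h2, neg_neg]
  rw [key, key, pd_comm v w hH]

lemma expand {ι : Type*} [Fintype ι] (b : OrthonormalBasis ι ℝ E) (A : E →L[ℝ] F) :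
    A = ∑ i, T (b i) (A (b i)) := by
  ext1 z
  conv_lhs => rw [← b.sum_repr' z]
  simp [T]

lemma sol_of_weak {ι : Type*} [Fintype ι] (b : OrthonormalBasis ι ℝ E) {𝒜 : Form E F} {H : E → F}
    (hH : ContDiff ℝ ∞ H)
    (hw : ∀ φ : E → F, ContDiff ℝ ∞ φ → tsupport φ ⊆ S → ∫ x, 𝒜 (fderiv ℝ H x) (fderiv ℝ φ x) = 0)
    (k : E) : Sol b 𝒜 (pd k H) := by
  refine ⟨(pd_contDiff hH).continuous, ?_⟩
  intro ψ hψ hs f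
  set g := pd k ψ with hg
  have hgs : ContDiff ℝ ∞ g := pd_contDiff hψ
  have hgS : tsupport g ⊆ S := (pd_tsupport _ _).trans hs
  have h0 := hw (fun x => g x • f) (hgs.smul contDiff_const)
    ((tsupport_smul_subset_left g (fun _ => f)).trans hgS)
  let L : ι → ι → F →L[ℝ] ℝ := fun i j =>
    LinearMap.toContinuousLinearMap ((𝒜.flip (T (b i) f)) ∘ₗ (TL (b j)))
  have hL : ∀ i j z, L i j z = 𝒜 (T (b j) z) (T (b i) f) := fun i j z => rfl
  have h1 : ∀ x, 𝒜 (fderiv ℝ H x) (fderiv ℝ (fun x => g x • f) x)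
      = ∑ i, ∑ j, L i j (pd (b i) g x • pd (b j) H x) := by
    intro x
    have e1 : fderiv ℝ (fun x => g x • f) x = ∑ i, pd (b i) g x • T (b i) f := by
      have : HasFDerivAt (fun x => g x • f) ((fderiv ℝ g x).smulRight f) x :=
        (hgs.differentiable (by simp) x).hasFDerivAt.smul_const f
      rw [this.fderiv, expand b ((fderiv ℝ g x).smulRight f)]
      refine Finset.sum_congr rfl fun i _ => ?_
      exact (TL (b i)).map_smul _ _
    have e2 : fderiv ℝ H x = ∑ j, T (b j) (pd (b j) H x) := expand b _
    rw [e1, e2]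
    simp only [map_sum, map_smul, LinearMap.sum_apply, smul_eq_mul, Finset.mul_sum]
    simp only [hL]
  have hint : ∀ i j, Integrable (fun x => pd (b i) g x • pd (b j) H x) := fun i j =>
    int_sm (pd_contDiff hH).continuous (pd_contDiff hgs) ((pd_tsupport _ _).trans hgS)
  simp only [h1] at h0
  rw [integral_finsetSum _ (fun i _ => integrable_finsetSum _ fun j _ => (L i j).integrable_comp (hint i j))] at h0
  rw [← h0]
  refine Finset.sum_congr rfl fun i _ => ?_
  rw [integral_finsetSum _ (fun j _ => (L i j).integrable_comp (hint i j))]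
  refine Finset.sum_congr rfl fun j _ => ?_
  rw [(L i j).integral_comp_comm (hint i j), hL]
  congr 3
  rw [hg, pd_comm (b i) k hψ]
  exact swap hH (pd_contDiff hψ) ((pd_tsupport _ _).trans hs) _ _

lemma point_est {ι : Type*} [Fintype ι] (b : OrthonormalBasis ι ℝ E) {κ K : ℝ} (hκ : 0 < κ) (hK : 0 < K) :
    ∃ C : ℝ, 0 ≤ C ∧ ∀ (𝒜 : Form E F), Ell κ K 𝒜 → ∀ u : E → F, Sol b 𝒜 u → ContDiff ℝ ∞ u →
      ∀ x ∈ Metric.ball (0:E) (1/2), ‖u x‖ ≤ C * (∫ x in S, ‖u x‖) ∧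
        ∀ i, ‖pd (b i) u x‖ ≤ C * ∫ x in S, ‖u x‖ := by
  obtain ⟨Cn, hCn, hinv⟩ := inv_bound (E := E)
  set d := Module.finrank ℝ E with hd
  let B : ContDiffBump (0:E) := ⟨1/2, 3/4, by norm_num, by norm_num⟩
  set ζ : E → ℝ := fun x => B x with hζd
  have hζ : ContDiff ℝ ∞ ζ := B.contDiff
  have hs : tsupport ζ ⊆ S := by rw [hζd, B.tsupport_eq]
  obtain ⟨C, hC, hdec⟩ := decay (F := F) b hκ hK (d + 2) ζ hζ hs
  refine ⟨Cn * C, by positivity, ?_⟩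
  intro 𝒜 hA u hu hus x hx
  set U := ∫ x in S, ‖u x‖ with hU
  have hU0 : 0 ≤ U := integral_nonneg fun _ => norm_nonneg _
  have hdec := hdec 𝒜 hA u hu
  have near : ζ =ᶠ[nhds x] fun _ => 1 := by
    filter_upwards [Metric.isOpen_ball.mem_nhds hx] with y hy
    exact B.one_of_mem_closedBall (Metric.ball_subset_closedBall hy)
  have fin : ∀ z : F, (∀ f : F, |inner ℝ f z| ≤ Cn * (C * U * ‖f‖)) → ‖z‖ ≤ Cn * C * U := by
    intro z hz
    have h1 := hz z
    rw [real_inner_self_eq_norm_sq, abs_of_nonneg (by positivity)] at h1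
    by_cases h : ‖z‖ = 0
    · rw [h]; positivity
    · have : 0 < ‖z‖ := lt_of_le_of_ne (norm_nonneg _) (Ne.symm h)
      refine le_of_mul_le_mul_right ?_ this
      nlinarith
  have hWs : ∀ f : F, ContDiff ℝ ∞ (fun y => ζ y * inner ℝ f (u y)) := fun f =>
    hζ.mul (contDiff_const.inner ℝ hus)
  have hWt : ∀ f : F, tsupport (fun y => ζ y * inner ℝ f (u y)) ⊆ S := fun f =>
    (tsupport_mul_subset_left).trans hs
  have hWI : ∀ (f : F) ξ θ, ∫ y, (ζ y * inner ℝ f (u y)) * cs ξ θ y = inner ℝ f (I u ζ ξ θ) := by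
    intro f ξ θ
    unfold I
    rw [← integral_inner (int_I hu.cont hζ hs ξ θ) f]
    congr 1; funext y
    rw [inner_smul_right]; ring
  have hWb : ∀ (f : F) ξ θ, (1 + ‖ξ‖) ^ (d + 2) * |∫ y, (ζ y * inner ℝ f (u y)) * cs ξ θ y| ≤ C * U * ‖f‖ := by
    intro f ξ θ
    rw [hWI]
    calc _ ≤ (1 + ‖ξ‖) ^ (d + 2) * (‖f‖ * ‖I u ζ ξ θ‖) := by
          gcongr; exact abs_real_inner_le_norm _ _
      _ = ((1 + ‖ξ‖) ^ (d + 2) * ‖I u ζ ξ θ‖) * ‖f‖ := by ring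
      _ ≤ _ := mul_le_mul_of_nonneg_right (hdec ξ θ) (norm_nonneg _)
  constructor
  · apply fin
    intro f
    have := hinv (fun y => ζ y * inner ℝ f (u y)) (hWs f).continuous
      ((hWs f).continuous.integrable_of_hasCompactSupport (hcs (hWt f))) (C * U * ‖f‖) (by positivity)
      (fun ξ θ => le_trans (by gcongr <;> simp) (hWb f ξ θ)) x
    simpa [near.self_of_nhds] using this
  · intro i
    apply fin
    intro f
    set w := (fun y => ζ y * inner ℝ f (u y)) with hw
    have hwS : tsupport (pd (b i) w) ⊆ S := (pd_tsupport _ _).trans (hWt f)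
    have hibp : ∀ ξ θ, ∫ y, pd (b i) w y * cs ξ θ y = - (inner ℝ ξ (b i) * ∫ y, w y * cs ξ (θ + Real.pi / 2) y) := by
      intro ξ θ
      have h := integral_smul_fderiv_eq_neg_fderiv_smul_of_integrable (μ := (volume : Measure E))
        (f := w) (g := cs ξ θ) (v := b i)
        (int_sm (cs_contDiff ξ θ).continuous (pd_contDiff (hWs f)) hwS)
        (int_sm (pd_contDiff (cs_contDiff ξ θ)).continuous (hWs f) (hWt f))
        (int_sm (cs_contDiff ξ θ).continuous (hWs f) (hWt f))
        (fun x _ => (hWs f).differentiable (by simp) x)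
        (fun x _ => (cs_contDiff ξ θ).differentiable (by simp) x)
      have h' : ∫ y, w y * pd (b i) (cs ξ θ) y = - ∫ y, pd (b i) w y * cs ξ θ y := h
      rw [← integral_const_mul, ← neg_eq_iff_eq_neg, ← h']
      congr 1; funext y
      rw [pd_cs]; ring
    have := hinv (pd (b i) w) (pd_contDiff (hWs f)).continuous
      ((pd_contDiff (hWs f)).continuous.integrable_of_hasCompactSupport (hcs hwS)) (C * U * ‖f‖) (by positivity)
      (fun ξ θ => by
        rw [hibp, abs_neg, abs_mul]
        refine le_trans ?_ (hWb f ξ (θ + Real.pi / 2))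
        have h1 : |inner ℝ ξ (b i)| ≤ 1 + ‖ξ‖ := by
          have := abs_real_inner_le_norm ξ (b i)
          simp at this; linarith
        calc _ ≤ (1 + ‖ξ‖) ^ (d + 1) * ((1 + ‖ξ‖) * |∫ y, w y * cs ξ (θ + Real.pi / 2) y|) := by gcongr
          _ = _ := by rw [pow_succ _ (d+1)]; ring) x
    have e : pd (b i) w x = inner ℝ f (pd (b i) u x) := by
      have hev : w =ᶠ[nhds x] fun y => inner ℝ f (u y) := by
        filter_upwards [near] with y hy
        simp [hw, hy]
      show fderiv ℝ w x (b i) = _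
      rw [hev.fderiv_eq]
      have : HasFDerivAt (fun y => inner ℝ f (u y)) ((innerSL ℝ f).comp (fderiv ℝ u x)) x :=
        (innerSL ℝ f).hasFDerivAt.comp x (hus.differentiable (by simp) x).hasFDerivAt
      rw [this.fderiv]; rfl
    rw [e] at this
    exact this

lemma norm_le_sum {ι : Type*} [Fintype ι] (b : OrthonormalBasis ι ℝ E) (A : E →L[ℝ] G) {c : ℝ} (hc : 0 ≤ c)
    (h : ∀ i, ‖A (b i)‖ ≤ c) : ‖A‖ ≤ Fintype.card ι * c := by
  refine A.opNorm_le_bound (by positivity) fun z => ?_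
  conv_lhs => rw [← b.sum_repr' z]
  rw [map_sum]
  calc _ ≤ ∑ i, ‖A ((inner ℝ (b i) z) • b i)‖ := norm_sum_le _ _
    _ ≤ ∑ i : ι, c * ‖z‖ := by
        refine Finset.sum_le_sum fun i _ => ?_
        rw [map_smul, norm_smul, mul_comm]
        gcongr
        · exact h i
        · simpa using norm_inner_le_norm (𝕜 := ℝ) (b i) z
    _ = _ := by simp; ring

lemma unit_est {ι : Type*} [Fintype ι] (b : OrthonormalBasis ι ℝ E) {κ K : ℝ} (hκ : 0 < κ) (hK : 0 < K) :
    ∃ C : ℝ, 0 ≤ C ∧ ∀ (𝒜 : Form E F), Ell κ K 𝒜 → ∀ H : E → F, ContDiff ℝ ∞ H →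
      (∀ φ : E → F, ContDiff ℝ ∞ φ → tsupport φ ⊆ S → ∫ x, 𝒜 (fderiv ℝ H x) (fderiv ℝ φ x) = 0) →
      ∀ x ∈ Metric.ball (0:E) (1/2), ∀ y ∈ Metric.ball (0:E) (1/2),
        ‖fderiv ℝ (fderiv ℝ H) x‖ + ‖fderiv ℝ H y‖ ≤ C * ∫ x in S, ‖fderiv ℝ H x‖ := by
  obtain ⟨C, hC, hp⟩ := point_est (F := F) b hκ hK
  set c : ℝ := (Fintype.card ι : ℝ) with hc
  refine ⟨c * (c * C) + c * C, by positivity, ?_⟩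
  intro 𝒜 hA H hH hw x hx y hy
  set V := ∫ x in S, ‖fderiv ℝ H x‖ with hV
  have hV0 : 0 ≤ V := integral_nonneg fun _ => norm_nonneg _
  have hUV : ∀ k, ∫ x in S, ‖pd (b k) H x‖ ≤ V := by
    intro k
    refine integral_mono ?_ ?_ ?_
    · exact ((pd_contDiff hH).continuous.norm.continuousOn).integrableOn_compact (isCompact_closedBall _ _)
    · exact ((hH.continuous_fderiv (by simp)).norm.continuousOn).integrableOn_compact (isCompact_closedBall _ _)
    · intro z
      have := (fderiv ℝ H z).le_opNorm (b k)
      simp only [b.norm_eq_one, mul_one] at this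
      exact this
  have hest := fun k => hp 𝒜 hA (pd (b k) H) (sol_of_weak b hH hw (b k)) (pd_contDiff hH)
  have h1 : ‖fderiv ℝ H y‖ ≤ c * (C * V) := by
    refine norm_le_sum b _ (by positivity) fun k => ?_
    refine ((hest k y hy).1).trans ?_
    gcongr; exact hUV k
  have h2 : ‖fderiv ℝ (fderiv ℝ H) x‖ ≤ c * (c * (C * V)) := by
    refine norm_le_sum b _ (by positivity) fun i => ?_
    refine norm_le_sum b _ (by positivity) fun k => ?_
    rw [← pd_pd _ _ hH]
    refine ((hest k x hx).2 i).trans ?_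
    gcongr; exact hUV k
  linarith

lemma cv (f : E → ℝ) (x₀ : E) {ρ : ℝ} (hρ : 0 < ρ) :
    ∫ y, f (x₀ + ρ • y) = (ρ ^ Module.finrank ℝ E)⁻¹ * ∫ x, f x := by
  have := Measure.integral_comp_smul (volume : Measure E) (fun z => f (x₀ + z)) ρ
  rw [this, integral_add_left_eq_self f x₀, abs_of_pos (by positivity), smul_eq_mul]

lemma fderiv_aff (f : E → G) (x₀ : E) (ρ : ℝ) (y : E) :
    fderiv ℝ (fun y => f (x₀ + ρ • y)) y = ρ • fderiv ℝ f (x₀ + ρ • y) := by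
  have := fderiv_comp_smul (𝕜 := ℝ) (f := fun z => f (x₀ + z)) (x := y) ρ
  rw [this, fderiv_comp_add_left]

lemma fderiv_aff2 (f : E → G) (x₀ : E) (ρ : ℝ) (y : E) :
    fderiv ℝ (fun y => ρ • f (x₀ + ρ • y)) y = (ρ * ρ) • fderiv ℝ f (x₀ + ρ • y) := by
  have h2 : (fun y => ρ • f (x₀ + ρ • y)) = ρ • (fun y => f (x₀ + ρ • y)) := rfl
  rw [h2, fderiv_const_smul_field, Pi.smul_apply, fderiv_aff, smul_smul]

lemma nsm (c : ℝ) (g : E →L[ℝ] G) : ‖c • g‖ = ‖c‖ * ‖g‖ := norm_smul c g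

lemma mem_aff (x₀ : E) {ρ : ℝ} (hρ : 0 < ρ) (r : ℝ) (y : E) :
    x₀ + ρ • y ∈ Metric.ball x₀ (ρ * r) ↔ y ∈ Metric.ball (0:E) r := by
  simp only [Metric.mem_ball, dist_eq_norm, add_sub_cancel_left, sub_zero, norm_smul, Real.norm_of_nonneg hρ.le]
  exact mul_lt_mul_iff_right₀ hρ

theorem main {ι : Type*} [Fintype ι] (b : OrthonormalBasis ι ℝ E) {κ K : ℝ} (hκ : 0 < κ) (hK : 0 < K) :
    ∃ c_a : ℝ, 0 < c_a ∧ ∀ (𝒜 : Form E F), Ell κ K 𝒜 →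
        ∀ (x₀ : E) (ρ : ℝ), 0 < ρ →
        ∀ h : E → F,
          ContDiffOn ℝ ∞ h (Metric.ball x₀ ρ) →
          IntegrableOn (fun x => ‖fderiv ℝ h x‖) (Metric.ball x₀ ρ) →
          (∀ φ : E → F,
            ContDiff ℝ 1 φ → HasCompactSupport φ → tsupport φ ⊆ Metric.ball x₀ ρ →
            ∫ x in Metric.ball x₀ ρ, 𝒜 (fderiv ℝ h x) (fderiv ℝ φ x) = 0) →
          ∀ x ∈ Metric.ball x₀ (ρ / 2), ∀ y ∈ Metric.ball x₀ (ρ / 2),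
            ρ * ‖fderiv ℝ (fderiv ℝ h) x‖ + ‖fderiv ℝ h y‖ ≤
              c_a * ⨍ z in Metric.ball x₀ ρ, ‖fderiv ℝ h z‖ := by
  obtain ⟨C, hC, hest⟩ := unit_est (F := F) b hκ hK
  set om := (volume : Measure E).real (Metric.ball (0:E) 1) with hom
  refine ⟨C * om + 1, by positivity, ?_⟩
  intro 𝒜 hA x₀ ρ hρ h hh hint hweak
  set d := Module.finrank ℝ E with hd
  let B : ContDiffBump (0:E) := ⟨4/5, 9/10, by norm_num, by norm_num⟩
  set H : E → F := fun y => B y • h (x₀ + ρ • y) with hH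
  have hρ1 : ∀ y, x₀ + ρ • y ∈ Metric.ball x₀ ρ ↔ y ∈ Metric.ball (0:E) 1 := fun y => by
    have := mem_aff x₀ hρ 1 y
    rwa [mul_one] at this
  have hHs : ContDiff ℝ ∞ H := by
    rw [contDiff_iff_contDiffAt]
    intro y
    by_cases hy : y ∉ tsupport H
    · have : H =ᶠ[nhds y] fun _ => 0 := notMem_tsupport_iff_eventuallyEq.1 hy
      exact contDiffAt_const.congr_of_eventuallyEq this
    rw [not_not] at hy
    have hy1 : y ∈ tsupport B := tsupport_smul_subset_left _ _ hy
    rw [B.tsupport_eq] at hy1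
    have hy2 : y ∈ Metric.ball (0:E) 1 := Metric.closedBall_subset_ball (by norm_num) hy1
    have h1 : ContDiffAt ℝ ∞ h (x₀ + ρ • y) :=
      hh.contDiffAt (Metric.isOpen_ball.mem_nhds ((hρ1 y).2 hy2))
    have h2 : ContDiffAt ℝ ∞ (fun y : E => x₀ + ρ • y) y := by fun_prop
    exact B.contDiff.contDiffAt.smul (h1.comp y h2)
  have hHeq : ∀ y ∈ Metric.ball (0:E) (4/5), fderiv ℝ H y = ρ • fderiv ℝ h (x₀ + ρ • y) := by
    intro y hy
    have : H =ᶠ[nhds y] fun y => h (x₀ + ρ • y) := by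
      filter_upwards [Metric.isOpen_ball.mem_nhds hy] with z hz
      simp [hH, B.one_of_mem_closedBall (Metric.ball_subset_closedBall hz)]
    rw [this.fderiv_eq, fderiv_aff]
  have hHeq2 : ∀ y ∈ Metric.ball (0:E) (4/5),
      fderiv ℝ (fderiv ℝ H) y = (ρ * ρ) • fderiv ℝ (fderiv ℝ h) (x₀ + ρ • y) := by
    intro y hy
    have : fderiv ℝ H =ᶠ[nhds y] fun y => ρ • fderiv ℝ h (x₀ + ρ • y) := by
      filter_upwards [Metric.isOpen_ball.mem_nhds hy] with z hz
      exact hHeq z hz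
    rw [this.fderiv_eq]
    exact fderiv_aff2 (fderiv ℝ h) x₀ ρ y
  have hSsub : (S : Set E) ⊆ Metric.ball (0:E) (4/5) := Metric.closedBall_subset_ball (by norm_num)
  have hw : ∀ φ : E → F, ContDiff ℝ ∞ φ → tsupport φ ⊆ S →
      ∫ x, 𝒜 (fderiv ℝ H x) (fderiv ℝ φ x) = 0 := by
    intro φ hφ hφS
    set φ' : E → F := fun x => φ (ρ⁻¹ • (x - x₀)) with hφ'
    have hback : ∀ y, φ' (x₀ + ρ • y) = φ y := by
      intro y; simp [hφ', smul_smul, hρ.ne']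
    have hD : ∀ y, fderiv ℝ φ y = ρ • fderiv ℝ φ' (x₀ + ρ • y) := by
      intro y
      rw [← fderiv_aff]
      congr 1; funext z; exact (hback z).symm
    have hsm : ContDiff ℝ ∞ φ' := hφ.comp (by fun_prop)
    have htc : tsupport φ' ⊆ Metric.closedBall x₀ (ρ * (3/4)) := by
      refine closure_minimal ?_ Metric.isClosed_closedBall
      intro x hx
      have : ρ⁻¹ • (x - x₀) ∈ tsupport φ := subset_tsupport _ hx
      have := hφS this
      simp only [S, Metric.mem_closedBall, dist_zero_right, norm_smul, norm_inv, Real.norm_of_nonneg hρ.le] at this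
      rw [Metric.mem_closedBall, dist_eq_norm]
      rwa [inv_mul_le_iff₀ hρ] at this
    have htb : tsupport φ' ⊆ Metric.ball x₀ ρ :=
      htc.trans (Metric.closedBall_subset_ball (by linarith))
    have h0 := hweak φ' (hsm.of_le (by exact_mod_cast le_top))
      ((isCompact_closedBall x₀ _).of_isClosed_subset (isClosed_tsupport _) htc) htb
    rw [setIntegral_eq_integral_of_forall_compl_eq_zero] at h0
    · have e : ∀ y, 𝒜 (fderiv ℝ H y) (fderiv ℝ φ y) =
          (ρ * ρ) * 𝒜 (fderiv ℝ h (x₀ + ρ • y)) (fderiv ℝ φ' (x₀ + ρ • y)) := by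
        intro y
        by_cases hy : y ∈ tsupport φ
        · rw [hHeq y (hSsub (hφS hy)), hD]
          simp only [map_smul, LinearMap.smul_apply, smul_eq_mul]; ring
        · have h1 : fderiv ℝ φ y = 0 :=
            image_eq_zero_of_notMem_tsupport (fun h => hy (tsupport_fderiv_subset ℝ h))
          have h2 : fderiv ℝ φ' (x₀ + ρ • y) = 0 := by
            have := hD y
            rw [h1] at this
            exact (smul_eq_zero.1 this.symm).resolve_left hρ.ne'
          rw [h1, h2]; simp
      simp only [e]
      rw [integral_const_mul, cv (fun x => 𝒜 (fderiv ℝ h x) (fderiv ℝ φ' x)) x₀ hρ, h0]; simp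
    · intro x hx
      have h1 : fderiv ℝ φ' x = 0 :=
        image_eq_zero_of_notMem_tsupport (fun h => hx (htb (tsupport_fderiv_subset ℝ h)))
      rw [h1]; simp
  have hfin := hest 𝒜 hA H hHs hw
  set Q : E → ℝ := (Metric.ball x₀ ρ).indicator (fun x => ‖fderiv ℝ h x‖) with hQ
  have hQi : Integrable Q := hint.integrable_indicator Metric.isOpen_ball.measurableSet
  have hQi' : Integrable (fun y => ρ * Q (x₀ + ρ • y)) :=
    (((hQi.comp_add_left x₀)).comp_smul hρ.ne').const_mul ρ
  have hQ0 : ∀ x, 0 ≤ Q x := fun x => Set.indicator_nonneg (fun _ _ => norm_nonneg _) x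
  have hQint : ∫ x, Q x = ∫ x in Metric.ball x₀ ρ, ‖fderiv ℝ h x‖ :=
    integral_indicator Metric.isOpen_ball.measurableSet
  have hVol : (volume : Measure E).real (Metric.ball x₀ ρ) = ρ ^ d * om := by
    rw [measureReal_def, Measure.addHaar_ball_of_pos _ x₀ hρ, ENNReal.toReal_mul,
      ENNReal.toReal_ofReal (by positivity)]; rfl
  have hom0 : 0 < om := by
    rw [hom]
    exact ENNReal.toReal_pos (Metric.measure_ball_pos _ _ one_pos).ne' measure_ball_lt_top.ne
  set av := ⨍ z in Metric.ball x₀ ρ, ‖fderiv ℝ h z‖ with hav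
  have hav' : (ρ ^ d)⁻¹ * ∫ x, Q x = om * av := by
    rw [hav, setAverage_eq, hVol, hQint, smul_eq_mul]
    field_simp
  have hav0 : 0 ≤ av := by
    have : 0 ≤ om * av := by rw [← hav']; exact mul_nonneg (by positivity) (integral_nonneg hQ0)
    exact nonneg_of_mul_nonneg_right this hom0
  have hV : ∫ y in S, ‖fderiv ℝ H y‖ ≤ ρ * (om * av) := by
    calc ∫ y in S, ‖fderiv ℝ H y‖ = ∫ y in S, ρ * Q (x₀ + ρ • y) := by
          refine setIntegral_congr_fun Metric.isClosed_closedBall.measurableSet ?_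
          intro y hy
          have hm : x₀ + ρ • y ∈ Metric.ball x₀ ρ :=
            (hρ1 y).2 (Metric.ball_subset_ball (by norm_num) (hSsub hy))
          simp only [hHeq y (hSsub hy), norm_smul, Real.norm_of_nonneg hρ.le, hQ, Set.indicator_of_mem hm]
      _ ≤ ∫ y, ρ * Q (x₀ + ρ • y) :=
          setIntegral_le_integral hQi' (Filter.Eventually.of_forall fun y => mul_nonneg hρ.le (hQ0 _))
      _ = _ := by rw [integral_const_mul, cv Q x₀ hρ, hav']
  intro x hx y hy
  have hback : ∀ z : E, x₀ + ρ • (ρ⁻¹ • (z - x₀)) = z := by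
    intro z; simp [smul_smul, hρ.ne']
  have hmem : ∀ z ∈ Metric.ball x₀ (ρ / 2), ρ⁻¹ • (z - x₀) ∈ Metric.ball (0:E) (1/2) := by
    intro z hz
    rw [← mem_aff x₀ hρ, hback]
    convert hz using 2; ring
  have h1 := hfin _ (hmem x hx) _ (hmem y hy)
  have hs2 : Metric.ball (0:E) (1/2) ⊆ Metric.ball (0:E) (4/5) := Metric.ball_subset_ball (by norm_num)
  rw [hHeq2 _ (hs2 (hmem x hx)), hHeq _ (hs2 (hmem y hy)), hback, hback, nsm, nsm,
    Real.norm_of_nonneg hρ.le, Real.norm_of_nonneg (mul_nonneg hρ.le hρ.le)] at h1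
  have h2 : ρ * (ρ * ‖fderiv ℝ (fderiv ℝ h) x‖ + ‖fderiv ℝ h y‖) ≤ ρ * (C * om * av) := by
    have := mul_le_mul_of_nonneg_left hV hC
    linarith
  have h3 := le_of_mul_le_mul_left h2 hρ
  linarith

end
end AHarm





theorem stmt_16 (n N : ℕ) (hn : 1 ≤ n) (hN : 1 ≤ N) (κ K : ℝ) (hκ : 0 < κ) (hK : 0 < K) :
    ∃ c_a : ℝ, 0 < c_a ∧
      ∀ 𝒜 : (EuclideanSpace ℝ (Fin n) →L[ℝ] EuclideanSpace ℝ (Fin N)) →ₗ[ℝ]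
            (EuclideanSpace ℝ (Fin n) →L[ℝ] EuclideanSpace ℝ (Fin N)) →ₗ[ℝ] ℝ,
        (∀ (η : EuclideanSpace ℝ (Fin n)) (ξ : EuclideanSpace ℝ (Fin N)),
          κ * ‖η‖ ^ 2 * ‖ξ‖ ^ 2 ≤
            𝒜 ((innerSL ℝ η).smulRight ξ) ((innerSL ℝ η).smulRight ξ)) →
        (∀ A B : EuclideanSpace ℝ (Fin n) →L[ℝ] EuclideanSpace ℝ (Fin N),
          |𝒜 A B| ≤ K * ‖A‖ * ‖B‖) →
        ∀ (x₀ : EuclideanSpace ℝ (Fin n)) (ρ : ℝ), 0 < ρ →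
        ∀ h : EuclideanSpace ℝ (Fin n) → EuclideanSpace ℝ (Fin N),
          ContDiffOn ℝ (⊤ : ℕ∞) h (Metric.ball x₀ ρ) →
          IntegrableOn (fun x => ‖fderiv ℝ h x‖) (Metric.ball x₀ ρ) →
          (∀ φ : EuclideanSpace ℝ (Fin n) → EuclideanSpace ℝ (Fin N),
            ContDiff ℝ 1 φ → HasCompactSupport φ → tsupport φ ⊆ Metric.ball x₀ ρ →
            ∫ x in Metric.ball x₀ ρ, 𝒜 (fderiv ℝ h x) (fderiv ℝ φ x) = 0) →
          ∀ x ∈ Metric.ball x₀ (ρ / 2), ∀ y ∈ Metric.ball x₀ (ρ / 2),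
            ρ * ‖fderiv ℝ (fderiv ℝ h) x‖ + ‖fderiv ℝ h y‖ ≤
              c_a * ⨍ z in Metric.ball x₀ ρ, ‖fderiv ℝ h z‖ := by
  obtain ⟨c, hc, hmain⟩ := AHarm.main (F := EuclideanSpace ℝ (Fin N))
    (EuclideanSpace.basisFun (Fin n) ℝ) hκ hK
  exact ⟨c, hc, fun 𝒜 h1 h2 => hmain 𝒜 ⟨h1, h2⟩⟩
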